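/- Suppose all the probabilities are distinct: p₁ > p₂ > ⋯ > p_k. Then the variance of ℓ_N satisfies Var(ℓ_N) = N p₁(1−p₁) + O(1) as N → ∞; that is, there is a constant C such that |Var(ℓ_N) − N p₁(1−p₁)| ≤ C for all N ≥ 1. Consequently the standard deviation of ℓ_N equals √(N p₁(1−p₁)) + O(N^{−1/2}). -/

import Mathlib

open MeasureTheory Filter
open scoped Classical

noncomputable section

/-- Length of the longest weakly increasing subsequence of the word `w`. -/
def lisLen {k N : ℕ} (w : Fin N → Fin k) : ℕ :=
  (Finset.univ.filter fun s : Finset (Fin N) =>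
    ∀ i ∈ s, ∀ j ∈ s, i ≤ j → w i ≤ w j).sup Finset.card

/-- Probability of the event `E` of words of length `N` under the i.i.d. measure
in which letter `i` has probability `p i`. -/
def wordProb (k N : ℕ) (p : Fin k → ℝ) (E : Set (Fin N → Fin k)) : ℝ :=
  ∑ w : Fin N → Fin k, E.indicator (fun w => ∏ i, p (w i)) w

/-- `T` is a semistandard Young tableau of shape `l` with entries in `{0,...,k-1}`. -/
def IsSSYT (k : ℕ) (l : Fin k → ℕ) (T : Fin k × ℕ → ℕ) : Prop :=
  (∀ (i : Fin k) (j1 j2 : ℕ), j1 ≤ j2 → j2 < l i → T (i, j1) ≤ T (i, j2)) ∧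
  (∀ (i1 i2 : Fin k) (j : ℕ), i1 < i2 → j < l i2 → T (i1, j) < T (i2, j)) ∧
  (∀ (i : Fin k) (j : ℕ), j < l i → T (i, j) < k) ∧
  (∀ (i : Fin k) (j : ℕ), l i ≤ j → T (i, j) = 0)

/-- The Schur polynomial `s_l(x)`, as the generating function of SSYT of shape `l`. -/
def schur (k : ℕ) (l : Fin k → ℕ) (x : Fin k → ℝ) : ℝ :=
  ∑ᶠ T ∈ {T | IsSSYT k l T}, ∏ v : Fin k,
    x v ^ ({c : Fin k × ℕ | c.2 < l c.1 ∧ T c = (v : ℕ)}.ncard)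

/-- `T` is a standard Young tableau of shape `l ⊢ N` (entries `0,...,N-1`, each once). -/
def IsSYT (k N : ℕ) (l : Fin k → ℕ) (T : Fin k × ℕ → ℕ) : Prop :=
  (∀ (i : Fin k) (j1 j2 : ℕ), j1 < j2 → j2 < l i → T (i, j1) < T (i, j2)) ∧
  (∀ (i1 i2 : Fin k) (j : ℕ), i1 < i2 → j < l i2 → T (i1, j) < T (i2, j)) ∧
  (∀ (i : Fin k) (j : ℕ), l i ≤ j → T (i, j) = 0) ∧
  Set.BijOn T {c : Fin k × ℕ | c.2 < l c.1} (Set.Iio N)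

/-- `f^l`: the number of standard Young tableaux of shape `l ⊢ N`. -/
def sytCount (k N : ℕ) (l : Fin k → ℕ) : ℕ := {T | IsSYT k N l T}.ncard

/-- The multinomial probability of the outcome `l` in `N` trials. -/
def multProb (k N : ℕ) (p : Fin k → ℝ) (l : Fin k → ℕ) : ℝ :=
  ((N.factorial : ℝ) / ∏ i, ((l i).factorial : ℝ)) * ∏ i, p i ^ l i

/-- The mean of `lisLen` over random words of length `N`. -/
def wordMean (k N : ℕ) (p : Fin k → ℝ) : ℝ :=
  ∑ w : Fin N → Fin k, (∏ i, p (w i)) * (lisLen w : ℝ)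

/-- The variance of `lisLen` over random words of length `N`. -/
def wordVar (k N : ℕ) (p : Fin k → ℝ) : ℝ :=
  ∑ w : Fin N → Fin k, (∏ i, p (w i)) * ((lisLen w : ℝ) - wordMean k N p) ^ 2


/-- The expectation of `f` over random words of length `N`. -/
def wordExp {k : ℕ} (p : Fin k → ℝ) (N : ℕ) (f : (Fin N → Fin k) → ℝ) : ℝ :=
  ∑ w : Fin N → Fin k, (∏ i, p (w i)) * f w

section Expectation

variable {k N : ℕ} {p : Fin k → ℝ}

lemma wordExp_add (f g : (Fin N → Fin k) → ℝ) :
    wordExp p N (fun w => f w + g w) = wordExp p N f + wordExp p N g := by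
  simp only [wordExp, mul_add, Finset.sum_add_distrib]

lemma wordExp_const_mul (c : ℝ) (f : (Fin N → Fin k) → ℝ) :
    wordExp p N (fun w => c * f w) = c * wordExp p N f := by
  simp only [wordExp, Finset.mul_sum]
  exact Finset.sum_congr rfl fun w _ => by ring

lemma wordExp_mono (hp : ∀ a, 0 ≤ p a) {f g : (Fin N → Fin k) → ℝ} (h : ∀ w, f w ≤ g w) :
    wordExp p N f ≤ wordExp p N g :=
  Finset.sum_le_sum fun w _ =>
    mul_le_mul_of_nonneg_left (h w) (Finset.prod_nonneg fun i _ => hp (w i))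

/-- Conditioning on the first letter. -/
lemma wordExp_succ (f : (Fin (N + 1) → Fin k) → ℝ) :
    wordExp p (N + 1) f =
      ∑ a, p a * wordExp p N (fun w => f (Fin.cons a w : Fin (N + 1) → Fin k)) := by
  unfold wordExp
  rw [← (Fin.consEquiv fun _ : Fin (N + 1) => Fin k).sum_comp, Fintype.sum_prod_type]
  refine Finset.sum_congr rfl fun a _ => ?_
  rw [Finset.mul_sum]
  refine Finset.sum_congr rfl fun w _ => ?_
  simp [Fin.consEquiv, Fin.prod_univ_succ, mul_assoc]

lemma wordExp_const (hsum : ∑ a, p a = 1) (c : ℝ) : wordExp p N (fun _ => c) = c := by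
  induction N with
  | zero => simp [wordExp]
  | succ N ih => rw [wordExp_succ]; simp [ih, ← Finset.sum_mul, hsum]

end Expectation

/-- Length of the longest weakly increasing subsequence of `w` with all letters at least `j`. -/
def lisLenFrom {k N : ℕ} (j : ℕ) (w : Fin N → Fin k) : ℕ :=
  (Finset.univ.filter fun s : Finset (Fin N) =>
    (∀ i ∈ s, j ≤ (w i : ℕ)) ∧ ∀ i ∈ s, ∀ i' ∈ s, i ≤ i' → w i ≤ w i').sup Finset.card

/-- The number of occurrences of the smallest letter in `w`. -/
def zeroCount {k N : ℕ} (w : Fin N → Fin k) : ℕ :=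
  ∑ i, if (w i : ℕ) = 0 then 1 else 0

section Combinatorics

variable {k N : ℕ}

lemma lisLenFrom_zero (w : Fin N → Fin k) : lisLenFrom 0 w = lisLen w := by
  simp [lisLenFrom, lisLen]

lemma card_le_lisLenFrom {j : ℕ} {w : Fin N → Fin k} {s : Finset (Fin N)}
    (hj : ∀ i ∈ s, j ≤ (w i : ℕ)) (hs : ∀ i ∈ s, ∀ i' ∈ s, i ≤ i' → w i ≤ w i') :
    s.card ≤ lisLenFrom j w :=
  Finset.le_sup (f := Finset.card) (by simpa using ⟨hj, hs⟩)

lemma lisLenFrom_le {j : ℕ} {w : Fin N → Fin k} {m : ℕ}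
    (h : ∀ s : Finset (Fin N), (∀ i ∈ s, j ≤ (w i : ℕ)) →
      (∀ i ∈ s, ∀ i' ∈ s, i ≤ i' → w i ≤ w i') → s.card ≤ m) :
    lisLenFrom j w ≤ m :=
  Finset.sup_le fun s hs => by
    simp only [Finset.mem_filter] at hs
    exact h s hs.2.1 hs.2.2

lemma lisLenFrom_eq_zero {j : ℕ} (hj : k ≤ j) (w : Fin N → Fin k) : lisLenFrom j w = 0 := by
  refine Nat.le_zero.1 (lisLenFrom_le fun s hs _ => ?_)
  rw [Nat.le_zero, Finset.card_eq_zero, Finset.eq_empty_iff_forall_notMem]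
  intro i hi
  have := hs i hi
  omega

lemma lisLen_le (w : Fin N → Fin k) : lisLen w ≤ N := by
  rw [← lisLenFrom_zero]
  exact lisLenFrom_le fun s _ _ => by simpa using Finset.card_le_univ s

lemma zeroCount_le_lisLen (w : Fin N → Fin k) : zeroCount w ≤ lisLen w := by
  rw [← lisLenFrom_zero, zeroCount, ← Finset.card_filter]
  refine card_le_lisLenFrom (fun _ _ => Nat.zero_le _) fun i hi i' _ _ => ?_
  rw [Finset.mem_filter] at hi
  exact Fin.le_def.2 (by omega)

lemma zeroCount_cons (a : Fin k) (w : Fin N → Fin k) :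
    zeroCount (Fin.cons a w : Fin (N + 1) → Fin k) =
      zeroCount w + if (a : ℕ) = 0 then 1 else 0 := by
  rw [zeroCount, Fin.sum_univ_succ, add_comm]
  simp only [Fin.cons_zero, Fin.cons_succ, zeroCount]

/-- The part of a position set of `Fin.cons a w` that lies in `w`. -/
def tailSet (s : Finset (Fin (N + 1))) : Finset (Fin N) :=
  Finset.univ.filter fun i => i.succ ∈ s

lemma card_eq_card_tailSet (s : Finset (Fin (N + 1))) :
    s.card = (tailSet s).card + if 0 ∈ s then 1 else 0 := by
  have h : s = Finset.univ.filter (· ∈ s) := by simp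
  conv_lhs => rw [h, Finset.card_filter, Fin.sum_univ_succ]
  rw [tailSet, Finset.card_filter, add_comm]

lemma card_tailSet_le {j : ℕ} {a : Fin k} {w : Fin N → Fin k} {s : Finset (Fin (N + 1))}
    (hj : ∀ i ∈ s, j ≤ ((Fin.cons a w : Fin (N + 1) → Fin k) i : ℕ))
    (hs : ∀ i ∈ s, ∀ i' ∈ s, i ≤ i' →
      (Fin.cons a w : Fin (N + 1) → Fin k) i ≤ (Fin.cons a w : Fin (N + 1) → Fin k) i') :
    (tailSet s).card ≤ lisLenFrom j w := by
  refine card_le_lisLenFrom (fun i hi => ?_) fun i hi i' hi' hii' => ?_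
  · simpa using hj i.succ (by simpa [tailSet] using hi)
  · simpa using hs i.succ (by simpa [tailSet] using hi) i'.succ (by simpa [tailSet] using hi')
      (by simpa using hii')

lemma lisLenFrom_cons_le (j : ℕ) (a : Fin k) (w : Fin N → Fin k) :
    lisLenFrom j (Fin.cons a w : Fin (N + 1) → Fin k) ≤
      max (lisLenFrom j w + if (a : ℕ) = j then 1 else 0)
        (lisLenFrom (j + 1) (Fin.cons a w : Fin (N + 1) → Fin k)) := by
  refine lisLenFrom_le fun s hj hs => ?_
  have hcard := card_eq_card_tailSet s
  have htail := card_tailSet_le hj hs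
  by_cases h0 : (0 : Fin (N + 1)) ∈ s
  · by_cases ha : (a : ℕ) = j
    · exact le_max_of_le_left (by simp only [h0, ha, if_true] at hcard ⊢; omega)
    · refine le_max_of_le_right (card_le_lisLenFrom (fun i hi => ?_) hs)
      have h1 := hj 0 h0
      have h2 := Fin.le_def.1 (hs 0 h0 i hi (Fin.zero_le i))
      simp only [Fin.cons_zero] at h1 h2
      omega
  · exact le_max_of_le_left (by simp only [h0, if_false] at hcard; omega)

lemma le_lisLen_cons (a : Fin k) (w : Fin N → Fin k) :
    lisLen w + (if (a : ℕ) = 0 then 1 else 0) ≤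
      lisLen (Fin.cons a w : Fin (N + 1) → Fin k) := by
  obtain ⟨s, hs, hcard⟩ := Finset.exists_mem_eq_sup
    (Finset.univ.filter fun s : Finset (Fin N) => ∀ i ∈ s, ∀ j ∈ s, i ≤ j → w i ≤ w j)
    ⟨∅, by simp⟩ Finset.card
  simp only [Finset.mem_filter, Finset.mem_univ, true_and] at hs
  let t : Finset (Fin (N + 1)) := Finset.univ.filter
    (Fin.cases ((a : ℕ) = 0) (fun i => i ∈ s) : Fin (N + 1) → Prop)
  have h0 : 0 ∈ t ↔ (a : ℕ) = 0 := by simp [t]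
  have hsucc : ∀ i : Fin N, i.succ ∈ t ↔ i ∈ s := fun i => by simp [t]
  have htail : tailSet t = s := by ext i; simp [tailSet, hsucc]
  have ht := card_eq_card_tailSet t
  simp only [htail, h0] at ht
  rw [lisLen, hcard, ← ht, ← lisLenFrom_zero]
  refine card_le_lisLenFrom (fun _ _ => Nat.zero_le _) fun i hi i' hi' hii' => ?_
  induction i using Fin.cases with
  | zero =>
    rw [Fin.le_def, Fin.cons_zero, h0.1 hi]
    exact Nat.zero_le _
  | succ i =>
    induction i' using Fin.cases with
    | zero => simp at hii'
    | succ i' =>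
      simpa using hs i ((hsucc i).1 hi) i' ((hsucc i').1 hi') (by simpa using hii')

lemma lisLen_cons_le (a : Fin k) (w : Fin N → Fin k) :
    lisLen (Fin.cons a w : Fin (N + 1) → Fin k) ≤ lisLen w + 1 := by
  simp only [← lisLenFrom_zero]
  refine lisLenFrom_le fun s hj hs => ?_
  have hcard := card_eq_card_tailSet s
  have htail := card_tailSet_le hj hs
  split_ifs at hcard <;> omega

/-- If prepending a letter other than the smallest one increases the length, then the longest
weakly increasing subsequences of the new word avoid the smallest letter. -/
lemma zeroCount_lt_lisLenFrom_one {a : Fin k} {w : Fin N → Fin k} (ha : (a : ℕ) ≠ 0)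
    (h : lisLen w < lisLen (Fin.cons a w : Fin (N + 1) → Fin k)) :
    zeroCount (Fin.cons a w : Fin (N + 1) → Fin k) <
      lisLenFrom 1 (Fin.cons a w : Fin (N + 1) → Fin k) := by
  have h1 := lisLenFrom_cons_le 0 a w
  have h2 := zeroCount_le_lisLen w
  simp only [lisLenFrom_zero, ha, if_false, add_zero, zero_add] at h1
  rw [zeroCount_cons, if_neg ha]
  omega

end Combinatorics

section ExponentialMoments

variable {k : ℕ} {p : Fin k → ℝ}

/-- The factor contributed by one letter to the exponential moment of
`lisLenFrom j - zeroCount`. -/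
def letterFactor (p : Fin k → ℝ) (z : ℝ) (j : ℕ) : ℝ :=
  ∑ a, p a * (z ^ (if (a : ℕ) = j then 1 else 0) * z⁻¹ ^ (if (a : ℕ) = 0 then 1 else 0))

/-- The exponential moment of `lisLenFrom j - zeroCount`. -/
def expMoment (p : Fin k → ℝ) (z : ℝ) (j N : ℕ) : ℝ :=
  wordExp p N fun w => z ^ lisLenFrom j w * z⁻¹ ^ zeroCount w

lemma expMoment_zero (z : ℝ) (j : ℕ) : expMoment p z j 0 = 1 := by
  have h : ∀ w : Fin 0 → Fin k, lisLenFrom j w = 0 := fun w =>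
    Nat.le_zero.1 (lisLenFrom_le fun s _ _ => by simpa using Finset.card_le_univ s)
  simp [expMoment, wordExp, h, zeroCount]

lemma letterFactor_mul_expMoment (z : ℝ) (j N : ℕ) :
    letterFactor p z j * expMoment p z j N = ∑ a, p a * wordExp p N fun w =>
      z ^ (lisLenFrom j w + if (a : ℕ) = j then 1 else 0) *
        z⁻¹ ^ zeroCount (Fin.cons a w : Fin (N + 1) → Fin k) := by
  rw [letterFactor, Finset.sum_mul]
  refine Finset.sum_congr rfl fun a _ => ?_
  rw [expMoment, mul_assoc, ← wordExp_const_mul]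
  congr 2
  funext w
  rw [zeroCount_cons, pow_add, pow_add]
  ring

lemma expMoment_succ_le (hp : ∀ a, 0 ≤ p a) {z : ℝ} (hz : 1 ≤ z) (j N : ℕ) :
    expMoment p z j (N + 1) ≤
      letterFactor p z j * expMoment p z j N + expMoment p z (j + 1) (N + 1) := by
  have hz0 : 0 ≤ z := zero_le_one.trans hz
  rw [letterFactor_mul_expMoment, expMoment, expMoment, wordExp_succ, wordExp_succ,
    ← Finset.sum_add_distrib]
  refine Finset.sum_le_sum fun a _ => ?_
  rw [← mul_add, ← wordExp_add]
  refine mul_le_mul_of_nonneg_left (wordExp_mono hp fun w => ?_) (hp a)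
  rw [← add_mul]
  refine mul_le_mul_of_nonneg_right ?_ (by positivity)
  refine (pow_le_pow_right₀ hz (lisLenFrom_cons_le j a w)).trans ?_
  rcases max_choice (lisLenFrom j w + if (a : ℕ) = j then 1 else 0)
    (lisLenFrom (j + 1) (Fin.cons a w : Fin (N + 1) → Fin k)) with h | h <;> rw [h]
  · exact le_add_of_nonneg_right (by positivity)
  · exact le_add_of_nonneg_left (by positivity)

lemma expMoment_succ_of_le {z : ℝ} {j : ℕ} (hj : k ≤ j) (N : ℕ) :
    expMoment p z j (N + 1) = letterFactor p z j * expMoment p z j N := by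
  rw [letterFactor_mul_expMoment, expMoment, wordExp_succ]
  refine Finset.sum_congr rfl fun a _ => ?_
  simp [lisLenFrom_eq_zero hj, (a.2.trans_le hj).ne]

lemma expMoment_nonneg (hp : ∀ a, 0 ≤ p a) {z : ℝ} (hz : 0 ≤ z) (j N : ℕ) :
    0 ≤ expMoment p z j N :=
  Finset.sum_nonneg fun w _ =>
    mul_nonneg (Finset.prod_nonneg fun i _ => hp (w i)) (by positivity)

lemma exists_expMoment_le (hp : ∀ a, 0 ≤ p a) {z ρ r : ℝ} (hz : 1 ≤ z) (hρ : 0 ≤ ρ)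
    (hr : ρ < r) (hfac : ∀ j, 1 ≤ j → letterFactor p z j ≤ ρ) (m : ℕ) :
    ∀ j, 1 ≤ j → k ≤ j + m → ∃ A : ℝ, 1 ≤ A ∧ ∀ N, expMoment p z j N ≤ A * r ^ N := by
  have hr0 : 0 < r := hρ.trans_lt hr
  have hpos := expMoment_nonneg hp (zero_le_one.trans hz)
  induction m with
  | zero =>
    intro j hj hk
    refine ⟨1, le_rfl, fun N => ?_⟩
    induction N with
    | zero => simp [expMoment_zero]
    | succ N ih =>
      rw [expMoment_succ_of_le (by simpa using hk)]
      calc letterFactor p z j * expMoment p z j N ≤ r * (1 * r ^ N) :=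
            mul_le_mul ((hfac j hj).trans hr.le) ih (hpos _ _) hr0.le
        _ = 1 * r ^ (N + 1) := by ring
  | succ m ih =>
    intro j hj hk
    obtain ⟨B, hB, hBN⟩ := ih (j + 1) (by omega) (by omega)
    have hA : 0 ≤ B * r / (r - ρ) :=
      div_nonneg (mul_nonneg (by linarith) hr0.le) (sub_pos.2 hr).le
    have hdiv : B * r / (r - ρ) * (r - ρ) = B * r := div_mul_cancel₀ _ (sub_pos.2 hr).ne'
    refine ⟨1 + B * r / (r - ρ), by linarith, fun N => ?_⟩
    induction N with
    | zero => simpa [expMoment_zero] using hA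
    | succ N ihN =>
      set A := 1 + B * r / (r - ρ)
      calc expMoment p z j (N + 1)
          ≤ letterFactor p z j * expMoment p z j N + expMoment p z (j + 1) (N + 1) :=
            expMoment_succ_le hp hz j N
        _ ≤ ρ * (A * r ^ N) + B * r ^ (N + 1) :=
            add_le_add (mul_le_mul (hfac j hj) ihN (hpos _ _) hρ) (hBN _)
        _ = (ρ * A + B * r) * r ^ N := by ring
        _ ≤ (A * r) * r ^ N := by
            refine mul_le_mul_of_nonneg_right ?_ (by positivity)
            nlinarith
        _ = A * r ^ (N + 1) := by ring

lemma letterFactor_eq (hsum : ∑ a, p a = 1) {z : ℝ} {j : ℕ} (hj : 1 ≤ j) :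
    letterFactor p z j = 1 + (z - 1) * (∑ a : Fin k, if (a : ℕ) = j then p a else 0) +
      (z⁻¹ - 1) * ∑ a : Fin k, if (a : ℕ) = 0 then p a else 0 := by
  rw [letterFactor, Finset.mul_sum, Finset.mul_sum]
  conv_rhs => enter [1, 1]; rw [← hsum]
  rw [← Finset.sum_add_distrib, ← Finset.sum_add_distrib]
  refine Finset.sum_congr rfl fun a _ => ?_
  by_cases h1 : (a : ℕ) = j
  · have h0 : (a : ℕ) ≠ 0 := by omega
    simp [h1, show j ≠ 0 by omega]
    ring
  · by_cases h0 : (a : ℕ) = 0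
    · simp [h0, show 0 ≠ j by omega]
      ring
    · simp [h0, h1]

lemma sum_ite_val_eq (i : Fin k) (f : Fin k → ℝ) :
    (∑ a : Fin k, if (a : ℕ) = (i : ℕ) then f a else 0) = f i := by
  simp [← Fin.ext_iff]

/-- If the smallest letter is strictly the most likely one, the one-letter factors are bounded
by some `ρ < 1` for a suitable `z > 1`. -/
lemma exists_letterFactor_le (hk : 2 ≤ k) (hp : ∀ a, 0 < p a) (hsum : ∑ a, p a = 1)
    (hdist : StrictAnti p) :
    ∃ z ρ : ℝ, 1 ≤ z ∧ 0 ≤ ρ ∧ ρ < 1 ∧ ∀ j, 1 ≤ j → letterFactor p z j ≤ ρ := by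
  have hk0 : 0 < k := by omega
  set i₀ : Fin k := ⟨0, hk0⟩ with hi₀
  set i₁ : Fin k := ⟨1, by omega⟩ with hi₁
  have h0 := hp i₀
  have h1 := hp i₁
  have h01 : p i₁ < p i₀ := hdist (by simp [hi₀, hi₁])
  set z : ℝ := (p i₀ + p i₁) / (2 * p i₁) with hz
  have hzp : z * p i₁ = (p i₀ + p i₁) / 2 := by rw [hz]; field_simp
  have hz1 : 1 < z := by rw [hz, lt_div_iff₀ (by positivity)]; linarith
  have hz0 : 0 < z := zero_lt_one.trans hz1
  have hzinv : z * z⁻¹ = 1 := mul_inv_cancel₀ hz0.ne'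
  have hzi : 0 < z⁻¹ := inv_pos.2 hz0
  have hle : ∀ j, 1 ≤ j →
      letterFactor p z j ≤ 1 + (z - 1) * p i₁ + (z⁻¹ - 1) * p i₀ := by
    intro j hj
    rw [letterFactor_eq hsum hj, show (0 : ℕ) = (i₀ : ℕ) from rfl, sum_ite_val_eq]
    have hq : (∑ a : Fin k, if (a : ℕ) = j then p a else 0) ≤ p i₁ := by
      by_cases hjk : j < k
      · rw [show j = ((⟨j, hjk⟩ : Fin k) : ℕ) from rfl, sum_ite_val_eq]
        exact hdist.antitone (Fin.le_def.2 hj)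
      · rw [Finset.sum_eq_zero fun a _ => if_neg (by omega)]
        exact h1.le
    have := mul_le_mul_of_nonneg_left hq (sub_pos.2 hz1).le
    linarith
  refine ⟨z, _, hz1.le, ?_, ?_, hle⟩
  · exact (Finset.sum_nonneg fun a _ => mul_nonneg (hp a).le (by positivity) :
      0 ≤ letterFactor p z 1).trans (hle 1 le_rfl)
  · have hfac : (z - 1) * p i₁ + (z⁻¹ - 1) * p i₀ = (z - 1) * z⁻¹ * (z * p i₁ - p i₀) := by
      linear_combination (p i₀ - (z - 1) * p i₁) * hzinv
    have : (z - 1) * z⁻¹ * (p i₀ - z * p i₁) > 0 :=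
      mul_pos (mul_pos (sub_pos.2 hz1) hzi) (by linarith)
    nlinarith

end ExponentialMoments

section Variance

variable {k N : ℕ} {p : Fin k → ℝ}

/-- The increment of `lisLen` when the first letter is added, minus the indicator that this
letter is the smallest one. -/
def excess (w : Fin (N + 1) → Fin k) : ℝ :=
  lisLen w - lisLen (Fin.tail w) - if (w 0 : ℕ) = 0 then 1 else 0

lemma excess_nonneg (w : Fin (N + 1) → Fin k) : 0 ≤ excess w := by
  have h := le_lisLen_cons (w 0) (Fin.tail w)
  rw [Fin.cons_self_tail] at h
  have h' : (lisLen (Fin.tail w) : ℝ) + (if (w 0 : ℕ) = 0 then 1 else 0) ≤ lisLen w := by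
    exact_mod_cast h
  rw [excess]
  linarith

lemma excess_le_one (w : Fin (N + 1) → Fin k) : excess w ≤ 1 := by
  have h := lisLen_cons_le (w 0) (Fin.tail w)
  rw [Fin.cons_self_tail] at h
  have h' : (lisLen w : ℝ) ≤ lisLen (Fin.tail w) + 1 := by exact_mod_cast h
  rw [excess]
  split_ifs <;> linarith

lemma excess_le {z : ℝ} (hz : 1 ≤ z) (w : Fin (N + 1) → Fin k) :
    excess w ≤ z ^ lisLenFrom 1 w * z⁻¹ ^ zeroCount w := by
  have hz0 : 0 < z := zero_lt_one.trans_le hz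
  have hpos : 0 ≤ z ^ lisLenFrom 1 w * z⁻¹ ^ zeroCount w := by positivity
  have hle := lisLen_cons_le (w 0) (Fin.tail w)
  rw [Fin.cons_self_tail] at hle
  by_cases h : (w 0 : ℕ) ≠ 0 ∧ lisLen (Fin.tail w) < lisLen w
  · have hlt := zeroCount_lt_lisLenFrom_one h.1 (w := Fin.tail w)
      (by rw [Fin.cons_self_tail]; exact h.2)
    rw [Fin.cons_self_tail] at hlt
    refine (excess_le_one w).trans ?_
    rw [inv_pow, ← div_eq_mul_inv, one_le_div (by positivity)]
    exact pow_le_pow_right₀ hz hlt.le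
  · refine le_trans ?_ hpos
    rw [excess]
    by_cases h0 : (w 0 : ℕ) = 0
    · have : (lisLen w : ℝ) ≤ lisLen (Fin.tail w) + 1 := by exact_mod_cast hle
      rw [if_pos h0]
      linarith
    · have : (lisLen w : ℝ) ≤ lisLen (Fin.tail w) := by
        exact_mod_cast not_lt.1 fun hlt => h ⟨h0, hlt⟩
      rw [if_neg h0]
      linarith

lemma wordExp_excess_le (hp : ∀ a, 0 ≤ p a) {z : ℝ} (hz : 1 ≤ z) :
    wordExp p (N + 1) excess ≤ expMoment p z 1 (N + 1) :=
  wordExp_mono hp (excess_le hz)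

lemma wordMean_nonneg (hp : ∀ a, 0 ≤ p a) : 0 ≤ wordMean k N p :=
  Finset.sum_nonneg fun w _ =>
    mul_nonneg (Finset.prod_nonneg fun i _ => hp (w i)) (Nat.cast_nonneg _)

lemma wordMean_le (hp : ∀ a, 0 ≤ p a) (hsum : ∑ a, p a = 1) : wordMean k N p ≤ N := by
  rw [← wordExp_const (N := N) hsum (N : ℝ)]
  exact wordExp_mono hp fun w => Nat.cast_le.2 (lisLen_le w)

/-- The centred sum of `lisLen` of the tail and the indicator that the first letter is the
smallest one, where `q` is the probability of the smallest letter. -/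
def centredStep (p : Fin k → ℝ) (q : ℝ) (w : Fin (N + 1) → Fin k) : ℝ :=
  (lisLen (Fin.tail w) - wordMean k N p) + ((if (w 0 : ℕ) = 0 then 1 else 0) - q)

lemma abs_centredStep_le (hp : ∀ a, 0 ≤ p a) (hsum : ∑ a, p a = 1) {q : ℝ}
    (hq0 : 0 ≤ q) (hq1 : q ≤ 1) (w : Fin (N + 1) → Fin k) :
    |centredStep p q w| ≤ N + 1 := by
  have h1 : (0 : ℝ) ≤ lisLen (Fin.tail w) := Nat.cast_nonneg _
  have h2 : (lisLen (Fin.tail w) : ℝ) ≤ N := Nat.cast_le.2 (lisLen_le _)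
  have h3 := wordMean_nonneg (N := N) hp
  have h4 := wordMean_le (N := N) hp hsum
  rw [centredStep, abs_le]
  split_ifs <;> constructor <;> linarith

lemma wordExp_lisLen_sub_mean (hsum : ∑ a, p a = 1) :
    wordExp p N (fun w => (lisLen w : ℝ) - wordMean k N p) = 0 := by
  simp only [sub_eq_add_neg]
  rw [wordExp_add, wordExp_const hsum]
  exact add_neg_cancel _

lemma sum_mul_indicator_sub (hk : 0 < k) (hsum : ∑ a, p a = 1) :
    ∑ a : Fin k, p a * ((if (a : ℕ) = 0 then 1 else 0) - p ⟨0, hk⟩) = 0 := by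
  have h := sum_ite_val_eq ⟨0, hk⟩ p
  simp only [mul_sub, Finset.sum_sub_distrib, ← Finset.sum_mul, hsum, mul_ite, mul_one, mul_zero]
  linarith

lemma sum_mul_indicator_sub_sq (hk : 0 < k) (hsum : ∑ a, p a = 1) :
    ∑ a : Fin k, p a * ((if (a : ℕ) = 0 then 1 else 0) - p ⟨0, hk⟩) ^ 2 =
      p ⟨0, hk⟩ * (1 - p ⟨0, hk⟩) := by
  have h := sum_ite_val_eq ⟨0, hk⟩ p
  have h' : ∀ a : Fin k, p a * ((if (a : ℕ) = 0 then 1 else 0) - p ⟨0, hk⟩) ^ 2 =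
      (1 - 2 * p ⟨0, hk⟩) * (if (a : ℕ) = 0 then p a else 0) + p a * p ⟨0, hk⟩ ^ 2 := by
    intro a
    split_ifs <;> ring
  simp only [h', Finset.sum_add_distrib, ← Finset.mul_sum, ← Finset.sum_mul, hsum]
  simp only at h
  rw [h]
  ring

lemma wordExp_centredStep (hk : 0 < k) (hsum : ∑ a, p a = 1) :
    wordExp p (N + 1) (centredStep p (p ⟨0, hk⟩)) = 0 := by
  rw [wordExp_succ]
  simp only [centredStep, Fin.tail_cons, Fin.cons_zero]
  simp only [wordExp_add, wordExp_lisLen_sub_mean hsum, wordExp_const hsum, zero_add]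
  exact sum_mul_indicator_sub hk hsum

lemma wordExp_centredStep_sq (hk : 0 < k) (hsum : ∑ a, p a = 1) :
    wordExp p (N + 1) (fun w => centredStep p (p ⟨0, hk⟩) w ^ 2) =
      wordVar k N p + p ⟨0, hk⟩ * (1 - p ⟨0, hk⟩) := by
  have h : ∀ a : Fin k, wordExp p N (fun w =>
      (((lisLen w : ℝ) - wordMean k N p) + ((if (a : ℕ) = 0 then 1 else 0) - p ⟨0, hk⟩)) ^ 2) =
      wordVar k N p + ((if (a : ℕ) = 0 then 1 else 0) - p ⟨0, hk⟩) ^ 2 := by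
    intro a
    generalize ((if (a : ℕ) = 0 then 1 else 0) - p ⟨0, hk⟩ : ℝ) = x
    have hsq : ∀ w : Fin N → Fin k, ((lisLen w : ℝ) - wordMean k N p + x) ^ 2 =
        (((lisLen w : ℝ) - wordMean k N p) ^ 2 + 2 * x * ((lisLen w : ℝ) - wordMean k N p)) +
          x ^ 2 := fun w => by ring
    simp only [hsq, wordExp_add, wordExp_const_mul, wordExp_lisLen_sub_mean hsum,
      wordExp_const hsum, mul_zero, add_zero]
    rfl
  rw [wordExp_succ]
  simp only [centredStep, Fin.tail_cons, Fin.cons_zero, h, mul_add, Finset.sum_add_distrib,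
    ← Finset.sum_mul, hsum, one_mul, sum_mul_indicator_sub_sq hk hsum]

lemma lisLen_sub_wordMean (hk : 0 < k) (hsum : ∑ a, p a = 1) (w : Fin (N + 1) → Fin k) :
    (lisLen w : ℝ) - wordMean k (N + 1) p =
      centredStep p (p ⟨0, hk⟩) w + (excess w - wordExp p (N + 1) excess) := by
  have hw : ∀ w : Fin (N + 1) → Fin k, (lisLen w : ℝ) =
      centredStep p (p ⟨0, hk⟩) w + (excess w + (wordMean k N p + p ⟨0, hk⟩)) := fun w => by
    rw [centredStep, excess]
    ring
  have hmean : wordMean k (N + 1) p =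
      wordExp p (N + 1) excess + (wordMean k N p + p ⟨0, hk⟩) := by
    change wordExp p (N + 1) (fun w => (lisLen w : ℝ)) = _
    simp only [hw]
    rw [wordExp_add, wordExp_add, wordExp_const hsum, wordExp_centredStep hk hsum, zero_add]
  rw [hmean, hw w]
  ring

/-- One more letter changes the variance by `p₁(1-p₁)`, up to an error controlled by the mean
excess. -/
lemma abs_wordVar_succ_sub_le (hk : 0 < k) (hp : ∀ a, 0 ≤ p a ∧ p a ≤ 1)
    (hsum : ∑ a, p a = 1) :
    |wordVar k (N + 1) p - (wordVar k N p + p ⟨0, hk⟩ * (1 - p ⟨0, hk⟩))| ≤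
      (2 * N + 3) * wordExp p (N + 1) excess := by
  set Y : (Fin (N + 1) → Fin k) → ℝ := centredStep p (p ⟨0, hk⟩)
  set e := wordExp p (N + 1) excess with he
  have hp0 : ∀ a, 0 ≤ p a := fun a => (hp a).1
  have habs : ∀ w, |Y w| ≤ N + 1 :=
    abs_centredStep_le hp0 hsum (hp _).1 (hp _).2
  have hvar : wordVar k (N + 1) p - (wordVar k N p + p ⟨0, hk⟩ * (1 - p ⟨0, hk⟩)) =
      wordExp p (N + 1) (fun w => (2 * Y w + excess w) * excess w) - e ^ 2 := by
    have hsq : ∀ w, ((lisLen w : ℝ) - wordMean k (N + 1) p) ^ 2 =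
        (2 * Y w + excess w) * excess w + (Y w ^ 2 + ((-2 * e) * Y w + ((-2 * e) * excess w +
          e ^ 2))) := fun w => by
      rw [lisLen_sub_wordMean hk hsum]
      ring
    change wordExp p (N + 1) (fun w => ((lisLen w : ℝ) - wordMean k (N + 1) p) ^ 2) - _ = _
    simp only [hsq]
    rw [wordExp_add, wordExp_add, wordExp_add, wordExp_add, wordExp_const_mul,
      wordExp_const_mul, wordExp_const hsum, wordExp_centredStep hk hsum,
      wordExp_centredStep_sq hk hsum, ← he]
    ring
  have he0 : 0 ≤ e := Finset.sum_nonneg fun w _ =>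
    mul_nonneg (Finset.prod_nonneg fun i _ => hp0 (w i)) (excess_nonneg w)
  have he1 : e ≤ 1 := by
    rw [← wordExp_const (N := N + 1) hsum (1 : ℝ)]
    exact wordExp_mono hp0 excess_le_one
  have hupper : wordExp p (N + 1) (fun w => (2 * Y w + excess w) * excess w) ≤
      (2 * N + 3) * e := by
    rw [he, ← wordExp_const_mul]
    refine wordExp_mono hp0 fun w => mul_le_mul_of_nonneg_right ?_ (excess_nonneg w)
    linarith [(abs_le.1 (habs w)).2, excess_le_one w]
  have hlower : (-(2 * N + 2)) * e ≤
      wordExp p (N + 1) (fun w => (2 * Y w + excess w) * excess w) := by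
    rw [he, ← wordExp_const_mul]
    refine wordExp_mono hp0 fun w => mul_le_mul_of_nonneg_right ?_ (excess_nonneg w)
    linarith [(abs_le.1 (habs w)).1, excess_nonneg w]
  have hee : e ^ 2 ≤ e := by nlinarith
  rw [hvar, abs_le]
  constructor <;> nlinarith [sq_nonneg e]

lemma wordVar_zero : wordVar k 0 p = 0 := by
  simp [wordVar, wordMean]

lemma wordVar_nonneg (hp : ∀ a, 0 ≤ p a) : 0 ≤ wordVar k N p :=
  Finset.sum_nonneg fun w _ =>
    mul_nonneg (Finset.prod_nonneg fun i _ => hp (w i)) (sq_nonneg _)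

theorem exists_abs_wordVar_sub_le (hk : 2 ≤ k) (hk0 : 0 < k) (hp : ∀ a, 0 < p a ∧ p a < 1)
    (hsum : ∑ a, p a = 1) (hdist : StrictAnti p) :
    ∃ C : ℝ, ∀ N : ℕ,
      |wordVar k N p - N * (p ⟨0, hk0⟩ * (1 - p ⟨0, hk0⟩))| ≤ C := by
  obtain ⟨z, ρ, hz, hρ0, hρ1, hfac⟩ :=
    exists_letterFactor_le hk (fun a => (hp a).1) hsum hdist
  obtain ⟨r, hr, hr1⟩ := exists_between hρ1
  have hr0 : 0 ≤ r := hρ0.trans hr.le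
  have hp0 : ∀ a, 0 ≤ p a := fun a => (hp a).1.le
  obtain ⟨A, hA, hAN⟩ := exists_expMoment_le hp0 hz hρ0 hr hfac k 1 le_rfl (by omega)
  have hbound : Summable fun n : ℕ => (2 * (n : ℝ) + 3) * (A * r ^ (n + 1)) := by
    have h1 := summable_pow_mul_geometric_of_norm_lt_one (R := ℝ) 1
      (by rwa [Real.norm_of_nonneg hr0] : ‖r‖ < 1)
    have h2 := summable_geometric_of_lt_one hr0 hr1
    refine ((h1.mul_left (2 * A * r)).add (h2.mul_left (3 * A * r))).congr fun n => ?_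
    ring
  have hstep : ∀ N : ℕ,
      |wordVar k N p - N * (p ⟨0, hk0⟩ * (1 - p ⟨0, hk0⟩))| ≤
        ∑ n ∈ Finset.range N, (2 * (n : ℝ) + 3) * (A * r ^ (n + 1)) := by
    intro N
    induction N with
    | zero => simp [wordVar_zero]
    | succ N ih =>
      have h1 := abs_wordVar_succ_sub_le (N := N) hk0
        (fun a => ⟨(hp a).1.le, (hp a).2.le⟩) hsum
      have h2 := mul_le_mul_of_nonneg_left ((wordExp_excess_le hp0 hz).trans (hAN (N + 1)))
        (by positivity : (0 : ℝ) ≤ 2 * N + 3)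
      rw [Finset.sum_range_succ, add_comm (Finset.sum _ _)]
      refine le_trans (le_of_eq_of_le ?_ (abs_add_le _ _)) (add_le_add (h1.trans h2) ih)
      push_cast
      congr 1
      ring
  exact ⟨_, fun N => (hstep N).trans
    (hbound.sum_le_tsum _ fun n _ => by positivity)⟩

end Variance

lemma abs_sqrt_sub_sqrt_le {x y : ℝ} (hx : 0 ≤ x) (hy : 0 < y) :
    |√x - √y| ≤ |x - y| / √y := by
  have hsy : 0 < √y := Real.sqrt_pos.2 hy
  have hfac : x - y = (√x - √y) * (√x + √y) := by
    linear_combination -Real.sq_sqrt hx + Real.sq_sqrt hy.le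
  rw [le_div_iff₀ hsy, hfac, abs_mul]
  refine mul_le_mul_of_nonneg_left ?_ (abs_nonneg _)
  exact (le_add_of_nonneg_left (Real.sqrt_nonneg x)).trans (le_abs_self _)

/-- If all the probabilities are distinct, then
`Var(ℓ_N) = Np₁(1-p₁) + O(1)`, and consequently the standard deviation of `ℓ_N`
equals `√(Np₁(1-p₁)) + O(N^{-1/2})`. -/
theorem random_words_variance_asymptotics
    (k : ℕ) (hk : 2 ≤ k) (p : Fin k → ℝ)
    (hp : ∀ i, 0 < p i ∧ p i < 1) (hsum : ∑ i, p i = 1)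
    (hdist : StrictAnti p) :
    ∃ C : ℝ, ∀ N : ℕ, 1 ≤ N →
      |wordVar k N p - N * (p ⟨0, by omega⟩ * (1 - p ⟨0, by omega⟩))| ≤ C ∧
      |Real.sqrt (wordVar k N p) -
          Real.sqrt (N * (p ⟨0, by omega⟩ * (1 - p ⟨0, by omega⟩)))| ≤
        C / Real.sqrt N := by
  obtain ⟨C, hC⟩ := exists_abs_wordVar_sub_le hk (by omega) hp hsum hdist
  set σ : ℝ := p ⟨0, by omega⟩ * (1 - p ⟨0, by omega⟩)
  have hσ : 0 < σ := mul_pos (hp _).1 (sub_pos.2 (hp _).2)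
  refine ⟨max C (C / √σ), fun N hN => ⟨(hC N).trans (le_max_left _ _), ?_⟩⟩
  have hN0 : (0 : ℝ) < N := by exact_mod_cast hN
  calc |√(wordVar k N p) - √(N * σ)|
      ≤ |wordVar k N p - N * σ| / √(N * σ) :=
        abs_sqrt_sub_sqrt_le (wordVar_nonneg fun a => (hp a).1.le) (mul_pos hN0 hσ)
    _ ≤ C / √(N * σ) := div_le_div_of_nonneg_right (hC N) (Real.sqrt_nonneg _)
    _ = C / √σ / √N := by rw [Real.sqrt_mul hN0.le, div_div, mul_comm]
    _ ≤ max C (C / √σ) / √N :=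
        div_le_div_of_nonneg_right (le_max_right _ _) (Real.sqrt_nonneg _)
end
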